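/- For a positive integer n, let A(n) denote the number of partitions of n into parts congruent to ±1 or ±3 modulo 7. Let B(n) denote the number of bipartitions (π, λ) of n where π is a partition into distinct even parts greater than 2 with a gap of at least 4 between consecutive parts, λ is a partition into distinct parts, and, writing e_1 < e_2 < ⋯ for the parts of π in ascending order, for each j none of e_j/2 − 1, e_j/2, e_j/2 + 1 is a part of λ. Let C(n) denote the number of bipartitions (π, μ) of n where π is as above, μ is a partition into distinct parts, and for each j none of e_j/2 + j − 2, e_j/2 + j − 1, e_j/2 + j is a part of μ. Then A(n) = B(n) = C(n). -/

import Mathlib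

namespace RogersSelberg

open PowerSeries

/-- The weight of a pair `(S, L)`, where `S` holds the halves of the parts of the first partition
and `L` the parts of the second. -/
def weight (p : Finset ℕ × Finset ℕ) : ℕ := 2 * ∑ x ∈ p.1, x + ∑ y ∈ p.2, y

/-- The generating function by weight of a set of pairs. -/
noncomputable def genFun (A : Set (Finset ℕ × Finset ℕ)) : ℤ⟦X⟧ :=
  PowerSeries.mk fun n => ((A ∩ {p | weight p = n}).ncard : ℤ)

lemma finite_weight_eq (n : ℕ) : {p | weight p = n}.Finite := by
  refine ((Finset.range (n + 1)).powerset ×ˢ (Finset.range (n + 1)).powerset).finite_toSet.subset ?_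
  rintro ⟨S, L⟩ h
  simp only [weight, Set.mem_ofPred_eq] at h
  simp only [Finset.coe_product, Set.mem_prod, Finset.mem_coe, Finset.mem_powerset]
  constructor
  · intro x hx
    have := Finset.single_le_sum (f := fun i : ℕ => i) (fun _ _ => Nat.zero_le _) hx
    simp only [Finset.mem_range]; omega
  · intro x hx
    have := Finset.single_le_sum (f := fun i : ℕ => i) (fun _ _ => Nat.zero_le _) hx
    simp only [Finset.mem_range]; omega

lemma genFun_union {A B : Set (Finset ℕ × Finset ℕ)} (h : Disjoint A B) :
    genFun (A ∪ B) = genFun A + genFun B := by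
  ext n
  simp only [genFun, coeff_mk, map_add]
  rw [Set.union_inter_distrib_right, Set.ncard_union_eq
    (h.mono Set.inter_subset_left Set.inter_subset_left)
    ((finite_weight_eq n).subset Set.inter_subset_right)
    ((finite_weight_eq n).subset Set.inter_subset_right)]
  push_cast
  rfl

lemma genFun_image {A : Set (Finset ℕ × Finset ℕ)} {f : Finset ℕ × Finset ℕ → Finset ℕ × Finset ℕ}
    {k : ℕ} (hf : Set.InjOn f A) (hk : ∀ p ∈ A, weight (f p) = weight p + k) :
    genFun (f '' A) = X ^ k * genFun A := by
  ext n
  rw [coeff_X_pow_mul']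
  simp only [genFun, coeff_mk]
  split_ifs with h
  · rw [← (hf.mono (Set.inter_subset_left (t := {p | weight p = n - k}))).ncard_image]
    congr 2
    ext q
    simp only [Set.mem_inter_iff, Set.mem_image, Set.mem_ofPred_eq]
    constructor
    · rintro ⟨⟨p, hp, rfl⟩, hq⟩
      rw [hk p hp] at hq
      exact ⟨p, ⟨hp, by omega⟩, rfl⟩
    · rintro ⟨p, ⟨hp, hw⟩, rfl⟩
      exact ⟨⟨p, hp, rfl⟩, by rw [hk p hp]; omega⟩
  · rw [Nat.cast_eq_zero, Set.ncard_eq_zero ((finite_weight_eq n).subset Set.inter_subset_right)]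
    ext q
    simp only [Set.mem_inter_iff, Set.mem_image, Set.mem_ofPred_eq, Set.mem_empty_iff_false,
      iff_false]
    rintro ⟨⟨p, hp, rfl⟩, hq⟩
    rw [hk p hp] at hq
    omega

lemma X_pow_dvd_genFun_sub_one {A : Set (Finset ℕ × Finset ℕ)} {N : ℕ} (h0 : (∅, ∅) ∈ A)
    (h1 : ∀ p ∈ A, ∀ x ∈ p.1, N ≤ x) (h2 : ∀ p ∈ A, ∀ x ∈ p.2, N ≤ x) :
    (X : ℤ⟦X⟧) ^ N ∣ genFun A - 1 := by
  rw [X_pow_dvd_iff]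
  intro m hm
  have key : ∀ p ∈ A, weight p < N → p = (∅, ∅) := by
    rintro ⟨S, L⟩ hp hw
    simp only [weight] at hw
    rw [Prod.mk.injEq, Finset.eq_empty_iff_forall_notMem, Finset.eq_empty_iff_forall_notMem]
    constructor
    · intro x hx
      have := Finset.single_le_sum (f := fun i : ℕ => i) (fun _ _ => Nat.zero_le _) hx
      have := h1 _ hp x hx
      omega
    · intro x hx
      have := Finset.single_le_sum (f := fun i : ℕ => i) (fun _ _ => Nat.zero_le _) hx
      have := h2 _ hp x hx
      omega
  simp only [genFun, map_sub, coeff_mk, coeff_one]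
  split_ifs with h
  · subst h
    have : A ∩ {p | weight p = 0} = {(∅, ∅)} := by
      ext p
      simp only [Set.mem_inter_iff, Set.mem_ofPred_eq, Set.mem_singleton_iff]
      constructor
      · rintro ⟨hp, hw⟩
        exact key p hp (by omega)
      · rintro rfl
        exact ⟨h0, by simp [weight]⟩
    simp [this]
  · have : A ∩ {p | weight p = m} = ∅ := by
      ext p
      simp only [Set.mem_inter_iff, Set.mem_ofPred_eq, Set.mem_empty_iff_false, iff_false]
      rintro ⟨hp, hw⟩
      have := key p hp (by omega)
      subst this
      simp [weight] at hw
      omega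
    simp [this]

lemma weight_insert_left {S L : Finset ℕ} {a : ℕ} (h : a ∉ S) :
    weight (insert a S, L) = weight (S, L) + 2 * a := by
  simp only [weight, Finset.sum_insert h]; ring

lemma weight_insert_right {S L : Finset ℕ} {a : ℕ} (h : a ∉ L) :
    weight (S, insert a L) = weight (S, L) + a := by
  simp only [weight, Finset.sum_insert h]; ring

lemma injOn_insert_left {A : Set (Finset ℕ × Finset ℕ)} {a : ℕ} (h : ∀ p ∈ A, a ∉ p.1) :
    Set.InjOn (fun p : Finset ℕ × Finset ℕ => (insert a p.1, p.2)) A := by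
  rintro ⟨S, L⟩ hp ⟨S', L'⟩ hp' he
  simp only [Prod.mk.injEq] at he ⊢
  refine ⟨?_, he.2⟩
  rw [← Finset.erase_insert (show a ∉ S from h _ hp),
    ← Finset.erase_insert (show a ∉ S' from h _ hp'), he.1]

lemma injOn_insert_right {A : Set (Finset ℕ × Finset ℕ)} {a : ℕ} (h : ∀ p ∈ A, a ∉ p.2) :
    Set.InjOn (fun p : Finset ℕ × Finset ℕ => (p.1, insert a p.2)) A := by
  rintro ⟨S, L⟩ hp ⟨S', L'⟩ hp' he
  simp only [Prod.mk.injEq] at he ⊢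
  refine ⟨he.1, ?_⟩
  rw [← Finset.erase_insert (show a ∉ L from h _ hp),
    ← Finset.erase_insert (show a ∉ L' from h _ hp'), he.2]

lemma genFun_insert_left {A : Set (Finset ℕ × Finset ℕ)} {a : ℕ} (h : ∀ p ∈ A, a ∉ p.1) :
    genFun ((fun p : Finset ℕ × Finset ℕ => (insert a p.1, p.2)) '' A) =
      X ^ (2 * a) * genFun A :=
  genFun_image (injOn_insert_left h) fun p hp => weight_insert_left (h p hp)

lemma genFun_insert_right {A : Set (Finset ℕ × Finset ℕ)} {a : ℕ} (h : ∀ p ∈ A, a ∉ p.2) :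
    genFun ((fun p : Finset ℕ × Finset ℕ => (p.1, insert a p.2)) '' A) =
      X ^ a * genFun A :=
  genFun_image (injOn_insert_right h) fun p hp => weight_insert_right (h p hp)

/-- Pairs `(S, L)` such that distinct elements of `S` differ by at least `2`, no element of `L` is
within distance `1` of an element of `S`, all elements of `S` are at least `a` and all elements
of `L` are at least `b`. -/
def nearAvoiding (a b : ℕ) : Set (Finset ℕ × Finset ℕ) :=
  {p | (∀ x ∈ p.1, a ≤ x) ∧ (∀ y ∈ p.2, b ≤ y) ∧ (∀ x ∈ p.1, ∀ y ∈ p.1, x < y → x + 2 ≤ y) ∧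
    ∀ x ∈ p.1, ∀ y ∈ p.2, x + 1 < y ∨ y + 1 < x}

lemma nearAvoiding_eq_union_left (a : ℕ) :
    nearAvoiding (a + 1) (a + 1) = nearAvoiding (a + 2) (a + 1) ∪
      (fun p => (insert (a + 1) p.1, p.2)) '' nearAvoiding (a + 3) (a + 3) := by
  ext ⟨S, L⟩
  simp only [nearAvoiding, Set.mem_union, Set.mem_image, Set.mem_ofPred_eq, Prod.exists,
    Prod.mk.injEq]
  constructor
  · rintro ⟨hS, hL, hg, hd⟩
    by_cases h : a + 1 ∈ S
    · right
      refine ⟨S.erase (a + 1), L, ⟨?_, ?_, ?_, ?_⟩, Finset.insert_erase h, rfl⟩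
      · intro x hx
        have hx' := Finset.mem_erase.1 hx
        have h1 := hS x hx'.2
        have := hg _ h x hx'.2 (by omega)
        omega
      · intro y hy
        have := hd _ h y hy
        have := hL y hy
        omega
      · intro x hx y hy
        exact hg x (Finset.mem_of_mem_erase hx) y (Finset.mem_of_mem_erase hy)
      · intro x hx
        exact hd x (Finset.mem_of_mem_erase hx)
    · left
      refine ⟨fun x hx => ?_, hL, hg, hd⟩
      have := hS x hx
      have : x ≠ a + 1 := by rintro rfl; exact h hx
      omega
  · rintro (⟨hS, hL, hg, hd⟩ | ⟨S, L, ⟨hS, hL, hg, hd⟩, rfl, rfl⟩)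
    · exact ⟨fun x hx => (by have := hS x hx; omega), hL, hg, hd⟩
    · refine ⟨?_, fun y hy => (by have := hL y hy; omega), ?_, ?_⟩ <;>
        simp only [Finset.mem_insert] <;> grind

lemma nearAvoiding_eq_union_right (a : ℕ) :
    nearAvoiding (a + 1) a = nearAvoiding (a + 1) (a + 1) ∪
      (fun p => (p.1, insert a p.2)) '' nearAvoiding (a + 2) (a + 1) := by
  ext ⟨S, L⟩
  simp only [nearAvoiding, Set.mem_union, Set.mem_image, Set.mem_ofPred_eq, Prod.exists,
    Prod.mk.injEq]
  constructor
  · rintro ⟨hS, hL, hg, hd⟩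
    by_cases h : a ∈ L
    · right
      refine ⟨S, L.erase a, ⟨?_, ?_, hg, ?_⟩, rfl, Finset.insert_erase h⟩
      · intro x hx
        have := hd x hx a h
        have := hS x hx
        omega
      · intro y hy
        have hy' := Finset.mem_erase.1 hy
        have := hL y hy'.2
        omega
      · intro x hx y hy
        exact hd x hx y (Finset.mem_of_mem_erase hy)
    · left
      refine ⟨hS, fun x hx => ?_, hg, hd⟩
      have := hL x hx
      have : x ≠ a := by rintro rfl; exact h hx
      omega
  · rintro (⟨hS, hL, hg, hd⟩ | ⟨S, L, ⟨hS, hL, hg, hd⟩, rfl, rfl⟩)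
    · exact ⟨hS, fun x hx => (by have := hL x hx; omega), hg, hd⟩
    · refine ⟨fun y hy => (by have := hS y hy; omega), ?_, hg, ?_⟩ <;>
        simp only [Finset.mem_insert] <;> grind

lemma genFun_nearAvoiding_left (a : ℕ) :
    genFun (nearAvoiding (a + 1) (a + 1)) = genFun (nearAvoiding (a + 2) (a + 1)) +
      X ^ (2 * (a + 1)) * genFun (nearAvoiding (a + 3) (a + 3)) := by
  rw [nearAvoiding_eq_union_left, genFun_union, genFun_insert_left]
  · intro p hp h
    have := hp.1 _ h
    omega
  · rw [Set.disjoint_left]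
    rintro _ hq ⟨p, hp, rfl⟩
    have := hq.1 (a + 1) (Finset.mem_insert_self _ _)
    omega

lemma genFun_nearAvoiding_right (a : ℕ) :
    genFun (nearAvoiding (a + 1) a) = genFun (nearAvoiding (a + 1) (a + 1)) +
      X ^ a * genFun (nearAvoiding (a + 2) (a + 1)) := by
  rw [nearAvoiding_eq_union_right, genFun_union, genFun_insert_right]
  · intro p hp h
    have := hp.2.1 _ h
    omega
  · rw [Set.disjoint_left]
    rintro _ hq ⟨p, hp, rfl⟩
    have := hq.2.1 a (Finset.mem_insert_self _ _)
    omega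

/-- The number of elements of `S` that are at most `x`. -/
def rank (S : Finset ℕ) (x : ℕ) : ℕ := (S.filter (· ≤ x)).card

/-- Pairs `(S, L)` such that distinct elements of `S` differ by at least `2`, no element of `L` is
within distance `1` of `x + rank S x + s - 1` for an element `x` of `S`, all elements of `S` are
greater than `d` and all elements of `L` are at least `d + s`. -/
def rankAvoiding (d s : ℕ) : Set (Finset ℕ × Finset ℕ) :=
  {p | (∀ x ∈ p.1, d + 1 ≤ x) ∧ (∀ y ∈ p.2, d + s ≤ y) ∧
    (∀ x ∈ p.1, ∀ y ∈ p.1, x < y → x + 2 ≤ y) ∧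
    ∀ x ∈ p.1, ∀ y ∈ p.2, x + rank p.1 x + s < y ∨ y + 2 < x + rank p.1 x + s}

lemma rank_pos {S : Finset ℕ} {x : ℕ} (hx : x ∈ S) : 1 ≤ rank S x :=
  Finset.card_pos.2 ⟨x, by simp [hx]⟩

lemma rank_insert_self {S : Finset ℕ} {a : ℕ} (h : ∀ x ∈ S, a < x) :
    rank (insert a S) a = 1 := by
  rw [rank, Finset.card_eq_one]
  refine ⟨a, ?_⟩
  ext x
  simp only [Finset.mem_filter, Finset.mem_insert, Finset.mem_singleton]
  grind

lemma rank_insert_of_le {S : Finset ℕ} {a x : ℕ} (h : a ∉ S) (hx : a ≤ x) :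
    rank (insert a S) x = rank S x + 1 := by
  rw [rank, Finset.filter_insert, if_pos hx, Finset.card_insert_of_notMem (by simp [h]), rank]

lemma rankAvoiding_eq_union (d s : ℕ) :
    rankAvoiding d s = (rankAvoiding (d + 1) s ∪
      (fun p => (p.1, insert (d + s) p.2)) '' rankAvoiding (d + 1) s) ∪
      (fun p => (insert (d + 1) p.1, p.2)) '' rankAvoiding (d + 2) (s + 1) := by
  ext ⟨S, L⟩
  simp only [rankAvoiding, Set.mem_union, Set.mem_image, Set.mem_ofPred_eq, Prod.exists,
    Prod.mk.injEq]
  constructor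
  · rintro ⟨hS, hL, hg, hd⟩
    by_cases h : d + 1 ∈ S
    · right
      obtain ⟨T, hT, rfl⟩ : ∃ T, d + 1 ∉ T ∧ insert (d + 1) T = S :=
        ⟨S.erase (d + 1), Finset.notMem_erase _ _, Finset.insert_erase h⟩
      have hlt : ∀ x ∈ T, d + 3 ≤ x := by
        intro x hx
        have h1 := hS x (Finset.mem_insert_of_mem hx)
        have : x ≠ d + 1 := by rintro rfl; exact hT hx
        have := hg _ h x (Finset.mem_insert_of_mem hx) (by omega)
        omega
      refine ⟨T, L, ⟨hlt, ?_, ?_, ?_⟩, rfl, rfl⟩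
      · intro y hy
        have := hd _ h y hy
        rw [rank_insert_self fun x hx => (by have := hlt x hx; omega)] at this
        have := hL y hy
        omega
      · intro x hx y hy
        exact hg x (Finset.mem_insert_of_mem hx) y (Finset.mem_insert_of_mem hy)
      · intro x hx y hy
        have := hd x (Finset.mem_insert_of_mem hx) y hy
        rw [rank_insert_of_le hT (by have := hlt x hx; omega)] at this
        omega
    · left
      have hS' : ∀ x ∈ S, d + 2 ≤ x := by
        intro x hx
        have := hS x hx
        have : x ≠ d + 1 := by rintro rfl; exact h hx
        omega
      by_cases h' : d + s ∈ L
      · right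
        refine ⟨S, L.erase (d + s), ⟨hS', ?_, hg, ?_⟩, rfl, Finset.insert_erase h'⟩
        · intro y hy
          have hy' := Finset.mem_erase.1 hy
          have := hL y hy'.2
          omega
        · intro x hx y hy
          exact hd x hx y (Finset.mem_of_mem_erase hy)
      · left
        refine ⟨hS', fun x hx => ?_, hg, hd⟩
        have := hL x hx
        have : x ≠ d + s := by rintro rfl; exact h' hx
        omega
  · rintro ((⟨hS, hL, hg, hd⟩ | ⟨S, L, ⟨hS, hL, hg, hd⟩, rfl, rfl⟩) |
      ⟨S, L, ⟨hS, hL, hg, hd⟩, rfl, rfl⟩)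
    · exact ⟨fun x hx => (by have := hS x hx; omega), fun x hx => (by have := hL x hx; omega),
        hg, hd⟩
    · refine ⟨fun y hy => (by have := hS y hy; omega), ?_, hg, ?_⟩
      · simp only [Finset.mem_insert]; grind
      · intro x hx y hy
        have := rank_pos hx
        have := hS x hx
        rcases Finset.mem_insert.1 hy with rfl | hy
        · omega
        · exact hd x hx y hy
    · have hT : d + 1 ∉ S := fun h => by have := hS _ h; omega
      refine ⟨?_, fun y hy => (by have := hL y hy; omega), ?_, ?_⟩
      · simp only [Finset.mem_insert]; grind
      · simp only [Finset.mem_insert]; grind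
      · intro x hx y hy
        rcases Finset.mem_insert.1 hx with rfl | hx
        · rw [rank_insert_self fun x hx => (by have := hS x hx; omega)]
          have := hL y hy
          omega
        · rw [rank_insert_of_le hT (by have := hS x hx; omega)]
          have := hd x hx y hy
          omega

lemma genFun_rankAvoiding (d s : ℕ) :
    genFun (rankAvoiding d s) = (1 + X ^ (d + s)) * genFun (rankAvoiding (d + 1) s) +
      X ^ (2 * (d + 1)) * genFun (rankAvoiding (d + 2) (s + 1)) := by
  rw [rankAvoiding_eq_union, genFun_union, genFun_union, genFun_insert_left, genFun_insert_right]
  · ring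
  · intro p hp h
    have := hp.2.1 _ h
    omega
  · intro p hp h
    have := hp.1 _ h
    omega
  · rw [Set.disjoint_left]
    rintro _ hq ⟨p, hp, rfl⟩
    have := hq.2.1 (d + s) (Finset.mem_insert_self _ _)
    omega
  · rw [Set.disjoint_left]
    rintro _ (hq | ⟨q, hq, he⟩) ⟨p, hp, rfl⟩
    · have := hq.1 (d + 1) (Finset.mem_insert_self _ _)
      omega
    · simp only [Prod.mk.injEq] at he
      have := hq.1 (d + 1) (he.1 ▸ Finset.mem_insert_self _ _)
      omega

lemma X_pow_dvd_genFun_nearAvoiding_sub_one {a b N : ℕ} (ha : N ≤ a) (hb : N ≤ b) :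
    (X : ℤ⟦X⟧) ^ N ∣ genFun (nearAvoiding a b) - 1 :=
  X_pow_dvd_genFun_sub_one (by simp [nearAvoiding]) (fun _ hp x hx => ha.trans (hp.1 x hx))
    fun _ hp x hx => hb.trans (hp.2.1 x hx)

lemma X_pow_dvd_genFun_rankAvoiding_sub_one (d s : ℕ) :
    (X : ℤ⟦X⟧) ^ d ∣ genFun (rankAvoiding d s) - 1 :=
  X_pow_dvd_genFun_sub_one (by simp [rankAvoiding])
    (fun _ hp x hx => by have := hp.1 x hx; omega)
    fun _ hp x hx => by have := hp.2.1 x hx; omega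

/-- The defect of the relation that compares the offsets `s` and `s + 1`. -/
noncomputable def offsetDefect (d s : ℕ) : ℤ⟦X⟧ :=
  genFun (rankAvoiding d s) - genFun (rankAvoiding d (s + 1)) -
    X ^ (d + s) * genFun (rankAvoiding (d + 1) s)

lemma offsetDefect_eq (d s : ℕ) :
    offsetDefect d s = (1 + X ^ (d + s + 1)) * offsetDefect (d + 1) s +
      X ^ (2 * (d + 1)) * offsetDefect (d + 2) (s + 1) := by
  have h1 := genFun_rankAvoiding d s
  have h2 := genFun_rankAvoiding d (s + 1)
  have h3 := genFun_rankAvoiding (d + 1) s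
  simp only [offsetDefect]
  ring_nf at h1 h2 h3 ⊢
  linear_combination h1 - h2 - X ^ d * X ^ s * X * h3

lemma offsetDefect_eq_zero (d s : ℕ) : offsetDefect d s = 0 := by
  have key : ∀ N k d s, N ≤ d + k → (X : ℤ⟦X⟧) ^ N ∣ offsetDefect d s := by
    intro N k
    induction k with
    | zero =>
      intro d s hd
      refine (pow_dvd_pow X hd).trans ?_
      obtain ⟨u, hu⟩ := X_pow_dvd_genFun_rankAvoiding_sub_one d s
      obtain ⟨v, hv⟩ := X_pow_dvd_genFun_rankAvoiding_sub_one d (s + 1)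
      refine ⟨u - v - X ^ s * genFun (rankAvoiding (d + 1) s), ?_⟩
      rw [offsetDefect, add_zero]
      linear_combination hu - hv
    | succ k ih =>
      intro d s hd
      rw [offsetDefect_eq]
      exact ((ih (d + 1) s (by omega)).mul_left _).add ((ih (d + 2) (s + 1) (by omega)).mul_left _)
  ext n
  exact X_pow_dvd_iff.1 (key (n + 1) (n + 1) d s (by omega)) n (by omega)

lemma genFun_rankAvoiding_zero (d : ℕ) :
    genFun (rankAvoiding d 0) =
      genFun (rankAvoiding d 1) + X ^ d * genFun (rankAvoiding (d + 1) 0) := by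
  have := offsetDefect_eq_zero d 0
  rw [offsetDefect] at this
  linear_combination this

lemma genFun_rankAvoiding_one (d : ℕ) :
    genFun (rankAvoiding d 1) = genFun (rankAvoiding (d + 1) 0) +
      X ^ (2 * (d + 1)) * genFun (rankAvoiding (d + 2) 1) := by
  linear_combination genFun_rankAvoiding d 0 - genFun_rankAvoiding_zero d

/-- A sequence pair that satisfies the Rogers-Selberg recurrences modulo `X ^ K` vanishes modulo
`X ^ K` if it eventually does. -/
lemma X_pow_dvd_of_recurrence {K : ℕ} {f g : ℕ → ℤ⟦X⟧}
    (hf : ∀ m, X ^ K ∣ f m - (g m + X ^ (m + 1) * f (m + 1)))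
    (hg : ∀ m, X ^ K ∣ g m - (f (m + 1) + X ^ (2 * (m + 2)) * g (m + 2)))
    (hf' : ∀ m, K ≤ m → X ^ K ∣ f m) (hg' : ∀ m, K ≤ m → X ^ K ∣ g m) :
    X ^ K ∣ f 0 := by
  have key : ∀ k m, K ≤ m + k → X ^ K ∣ f m ∧ X ^ K ∣ g m := by
    intro k
    induction k with
    | zero => exact fun m hm => ⟨hf' m hm, hg' m hm⟩
    | succ k ih =>
      intro m hm
      have h1 := ih (m + 1) (by omega)
      have h2 := ih (m + 2) (by omega)
      have hgm : X ^ K ∣ g m := (dvd_iff_dvd_of_dvd_sub (hg m)).2 (h1.1.add (h2.2.mul_left _))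
      exact ⟨(dvd_iff_dvd_of_dvd_sub (hf m)).2 (hgm.add (h1.1.mul_left _)), hgm⟩
  exact (key K 0 (by omega)).1

lemma genFun_nearAvoiding_eq_genFun_rankAvoiding :
    genFun (nearAvoiding 2 1) = genFun (rankAvoiding 1 0) := by
  rw [← sub_eq_zero]
  ext n
  have key := X_pow_dvd_of_recurrence (K := n + 1)
    (f := fun m => genFun (nearAvoiding (m + 2) (m + 1)) - genFun (rankAvoiding (m + 1) 0))
    (g := fun m => genFun (nearAvoiding (m + 2) (m + 2)) - genFun (rankAvoiding (m + 1) 1))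
    ?_ ?_ ?_ ?_
  · exact X_pow_dvd_iff.1 key n (by omega)
  · intro m
    refine ⟨0, ?_⟩
    linear_combination genFun_nearAvoiding_right (m + 1) - genFun_rankAvoiding_zero (m + 1)
  · intro m
    refine ⟨0, ?_⟩
    linear_combination genFun_nearAvoiding_left (m + 1) - genFun_rankAvoiding_one (m + 1)
  · intro m hm
    have h1 := X_pow_dvd_genFun_nearAvoiding_sub_one (a := m + 2) (b := m + 1) (N := n + 1)
      (by omega) (by omega)
    have h2 := (pow_dvd_pow X (show n + 1 ≤ m + 1 by omega)).trans
      (X_pow_dvd_genFun_rankAvoiding_sub_one (m + 1) 0)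
    simpa using h1.sub h2
  · intro m hm
    have h1 := X_pow_dvd_genFun_nearAvoiding_sub_one (a := m + 2) (b := m + 2) (N := n + 1)
      (by omega) (by omega)
    have h2 := (pow_dvd_pow X (show n + 1 ≤ m + 1 by omega)).trans
      (X_pow_dvd_genFun_rankAvoiding_sub_one (m + 1) 1)
    simpa using h1.sub h2

/-- The pair of multisets encoded by a pair `(S, L)`. -/
def toMultisets (p : Finset ℕ × Finset ℕ) : Multiset ℕ × Multiset ℕ :=
  (p.1.val.map (2 * ·), p.2.val)

lemma toMultisets_injective : Function.Injective toMultisets := by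
  rintro ⟨S, L⟩ ⟨S', L'⟩ h
  simp only [toMultisets, Prod.mk.injEq] at h ⊢
  exact ⟨Finset.val_injective (Multiset.map_injective (fun a b (hab : 2 * a = 2 * b) => by omega)
    h.1), Finset.val_injective h.2⟩

lemma exists_toMultisets_eq {pl : Multiset ℕ × Multiset ℕ} (h1 : pl.1.Nodup)
    (he : ∀ x ∈ pl.1, Even x) (h2 : pl.2.Nodup) : ∃ p, toMultisets p = pl := by
  have h : (pl.1.map (· / 2)).map (2 * ·) = pl.1 := by
    rw [Multiset.map_map]
    conv_rhs => rw [← Multiset.map_id pl.1]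
    refine Multiset.map_congr rfl fun x hx => ?_
    have := he x hx
    simp only [Function.comp, id]
    grind
  exact ⟨(⟨pl.1.map (· / 2), Multiset.Nodup.of_map (2 * ·) (by rwa [h])⟩, ⟨pl.2, h2⟩),
    Prod.ext h rfl⟩

lemma sum_toMultisets (p : Finset ℕ × Finset ℕ) :
    (toMultisets p).1.sum + (toMultisets p).2.sum = weight p := by
  simp only [toMultisets, weight, Finset.mul_sum]
  rw [Finset.sum_eq_multiset_sum, Finset.sum_eq_multiset_sum, Multiset.map_id']

lemma card_filter_toMultisets (p : Finset ℕ × Finset ℕ) (x : ℕ) :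
    ((toMultisets p).1.filter (fun y => y ≤ 2 * x)).card = rank p.1 x := by
  simp only [toMultisets, rank, Multiset.filter_map, Multiset.card_map, Finset.card_def,
    Finset.filter_val]
  congr 1
  refine Multiset.filter_congr fun y _ => ?_
  simp

/-- Counting bipartitions with an avoidance condition through their encodings. -/
lemma card_bipartitions {n : ℕ} {A : Set (Finset ℕ × Finset ℕ)}
    {P : Multiset ℕ × Multiset ℕ → Prop}
    (hP : ∀ pl, P pl → pl.1.Nodup ∧ (∀ x ∈ pl.1, Even x) ∧ pl.2.Nodup)
    (hA : ∀ p, P (toMultisets p) ↔ p ∈ A ∧ weight p = n) :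
    (Nat.card {pl // P pl} : ℤ) = coeff n (genFun A) := by
  rw [genFun, coeff_mk, ← Set.ncard_image_of_injective _ toMultisets_injective]
  congr 1
  change Nat.card (Set.ofPred P) = _
  rw [Nat.card_coe_set_eq]
  congr 1
  ext pl
  constructor
  · intro h
    obtain ⟨h1, he, h2⟩ := hP pl h
    obtain ⟨p, rfl⟩ := exists_toMultisets_eq h1 he h2
    exact ⟨p, (hA p).1 h, rfl⟩
  · rintro ⟨p, hp, rfl⟩
    exact (hA p).2 hp

lemma card_near_bipartitions (n : ℕ) :
    (Nat.card {pl : Multiset ℕ × Multiset ℕ //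
        (∀ x ∈ pl.1, 0 < x) ∧ (∀ x ∈ pl.2, 0 < x) ∧ pl.1.sum + pl.2.sum = n ∧
        pl.1.Nodup ∧ (∀ x ∈ pl.1, Even x ∧ 2 < x) ∧
        (∀ x ∈ pl.1, ∀ y ∈ pl.1, x < y → x + 4 ≤ y) ∧
        pl.2.Nodup ∧
        ∀ x ∈ pl.1,
          x / 2 - 1 ∉ pl.2 ∧ x / 2 ∉ pl.2 ∧ x / 2 + 1 ∉ pl.2} : ℤ) =
      coeff n (genFun (nearAvoiding 2 1)) := by
  refine card_bipartitions (fun pl h => ⟨h.2.2.2.1, fun x hx => (h.2.2.2.2.1 x hx).1,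
    h.2.2.2.2.2.2.1⟩) fun p => ?_
  rw [sum_toMultisets]
  have hn1 : (toMultisets p).1.Nodup :=
    p.1.nodup.map fun a b (hab : 2 * a = 2 * b) => by omega
  have hn2 : (toMultisets p).2.Nodup := p.2.nodup
  simp only [hn1, hn2, true_and, nearAvoiding, Set.mem_ofPred_eq]
  simp only [toMultisets, Multiset.mem_map, Finset.mem_val, forall_exists_index, and_imp,
    forall_apply_eq_imp_iff₂]
  constructor
  · rintro ⟨h1, h2, rfl, h3, h4, h5⟩
    refine ⟨⟨fun x hx => (by have := h3 x hx; omega), h2, fun x hx y hy hxy =>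
      (by have := h4 x hx y hy; omega), fun x hx y hy => ?_⟩, rfl⟩
    have h6 := h5 x hx
    simp only [Nat.mul_div_cancel_left _ (show 0 < 2 by norm_num)] at h6
    have h7 : y ≠ x - 1 := by rintro rfl; exact h6.1 hy
    have h8 : y ≠ x := by rintro rfl; exact h6.2.1 hy
    have h9 : y ≠ x + 1 := by rintro rfl; exact h6.2.2 hy
    omega
  · rintro ⟨⟨h3, h2, h4, h5⟩, rfl⟩
    refine ⟨fun x hx => (by have := h3 x hx; omega), h2, rfl, fun x hx =>
      ⟨even_two_mul x, (by have := h3 x hx; omega)⟩, fun x hx y hy hxy =>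
      (by have := h4 x hx y hy; omega), fun x hx => ?_⟩
    simp only [Nat.mul_div_cancel_left _ (show 0 < 2 by norm_num)]
    have h6 := h5 x hx
    have h7 := h3 x hx
    refine ⟨fun hy => ?_, fun hy => ?_, fun hy => ?_⟩ <;>
    · have := h6 _ hy
      omega

lemma card_rank_bipartitions (n : ℕ) :
    (Nat.card {pl : Multiset ℕ × Multiset ℕ //
        (∀ x ∈ pl.1, 0 < x) ∧ (∀ x ∈ pl.2, 0 < x) ∧ pl.1.sum + pl.2.sum = n ∧
        pl.1.Nodup ∧ (∀ x ∈ pl.1, Even x ∧ 2 < x) ∧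
        (∀ x ∈ pl.1, ∀ y ∈ pl.1, x < y → x + 4 ≤ y) ∧
        pl.2.Nodup ∧
        ∀ x ∈ pl.1,
          x / 2 + (pl.1.filter (fun y => y ≤ x)).card - 2 ∉ pl.2 ∧
          x / 2 + (pl.1.filter (fun y => y ≤ x)).card - 1 ∉ pl.2 ∧
          x / 2 + (pl.1.filter (fun y => y ≤ x)).card ∉ pl.2} : ℤ) =
      coeff n (genFun (rankAvoiding 1 0)) := by
  refine card_bipartitions (fun pl h => ⟨h.2.2.2.1, fun x hx => (h.2.2.2.2.1 x hx).1,
    h.2.2.2.2.2.2.1⟩) fun p => ?_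
  rw [sum_toMultisets]
  have hn1 : (toMultisets p).1.Nodup :=
    p.1.nodup.map fun a b (hab : 2 * a = 2 * b) => by omega
  have hn2 : (toMultisets p).2.Nodup := p.2.nodup
  have hmem : ∀ Q : ℕ → Prop, (∀ x ∈ (toMultisets p).1, Q x) ↔ ∀ x ∈ p.1, Q (2 * x) := by
    simp [toMultisets]
  have hmem2 : ∀ y, y ∈ (toMultisets p).2 ↔ y ∈ p.2 := fun y => Iff.rfl
  simp only [hn1, hn2, true_and, rankAvoiding, Set.mem_ofPred_eq, hmem, hmem2,
    card_filter_toMultisets, Nat.mul_div_cancel_left _ (show 0 < 2 by norm_num)]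
  constructor
  · rintro ⟨h1, h2, rfl, h3, h4, h5⟩
    refine ⟨⟨fun x hx => (by have := h3 x hx; omega), h2, fun x hx y hy hxy =>
      (by have := h4 x hx y hy; omega), fun x hx y hy => ?_⟩, rfl⟩
    have h6 := h5 x hx
    have := rank_pos hx
    have h7 : y ≠ x + rank p.1 x - 2 := by rintro rfl; exact h6.1 hy
    have h8 : y ≠ x + rank p.1 x - 1 := by rintro rfl; exact h6.2.1 hy
    have h9 : y ≠ x + rank p.1 x := by rintro rfl; exact h6.2.2 hy
    omega
  · rintro ⟨⟨h3, h2, h4, h5⟩, rfl⟩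
    refine ⟨fun x hx => (by have := h3 x hx; omega), h2, rfl, fun x hx =>
      ⟨even_two_mul x, (by have := h3 x hx; omega)⟩, fun x hx y hy hxy =>
      (by have := h4 x hx y hy; omega), fun x hx => ?_⟩
    have h6 := h5 x hx
    have h7 := h3 x hx
    have := rank_pos hx
    refine ⟨fun hy => ?_, fun hy => ?_, fun hy => ?_⟩ <;>
    · have := h6 _ hy
      omega

/-- The `q`-shifted factorial `(1 - x) (1 - x q) ⋯ (1 - x q ^ (m - 1))` at `x = q ^ (n + 1)`. -/
noncomputable def shiftedFactorial (n m : ℕ) : ℤ⟦X⟧ := ∏ j ∈ Finset.range m, (1 - X ^ (n + j + 1))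

lemma shiftedFactorial_succ_right (n m : ℕ) :
    shiftedFactorial n (m + 1) = shiftedFactorial n m * (1 - X ^ (n + m + 1)) :=
  Finset.prod_range_succ _ _

lemma shiftedFactorial_succ_left (n m : ℕ) :
    (1 - X ^ (n + 1)) * shiftedFactorial (n + 1) m = shiftedFactorial n (m + 1) := by
  rw [shiftedFactorial, shiftedFactorial, Finset.prod_range_succ', mul_comm]
  congr 1
  refine Finset.prod_congr rfl fun j _ => ?_
  rw [show n + 1 + j + 1 = n + (j + 1) + 1 by ring]

lemma choose_succ_two (n : ℕ) : (n + 1).choose 2 = n + n.choose 2 := by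
  rw [Nat.choose_succ_succ' n 1, Nat.choose_one_right]

/-- The terms of Selberg's alternating series at `x = q ^ m`. -/
noncomputable def selbergTerm (i m n : ℕ) : ℤ⟦X⟧ :=
  (-1) ^ n * X ^ (3 * n * m + 7 * n.choose 2 + (7 - i) * n) * (1 - X ^ (i * (m + 2 * n + 1))) *
    shiftedFactorial n m

/-- The partial sums of Selberg's alternating series at `x = q ^ m`. -/
noncomputable def selbergSum (N i m : ℕ) : ℤ⟦X⟧ := ∑ n ∈ Finset.range N, selbergTerm i m n

lemma selbergSum_zero (N m : ℕ) : selbergSum N 0 m = 0 := by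
  simp [selbergSum, selbergTerm]

lemma selbergSum_sub (N m i : ℕ) (hi : i < 3) :
    selbergSum N (i + 1) m - selbergSum N i m = X ^ (i * (m + 1)) * selbergSum N (3 - i) (m + 1) -
      (-1) ^ N * (1 - X ^ N) * shiftedFactorial N m *
        X ^ (3 * N * m + 7 * N.choose 2 + (6 - i) * N) := by
  induction N with
  | zero => simp [selbergSum]
  | succ N ih =>
    have h : ∀ i m, selbergSum (N + 1) i m = selbergSum N i m + selbergTerm i m N :=
      fun i m => Finset.sum_range_succ _ _
    have hs : (-1) ^ (N + 1) * (1 - X ^ (N + 1)) * shiftedFactorial (N + 1) m =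
        -((-1) ^ N * (shiftedFactorial N m * (1 - X ^ (N + m + 1)))) := by
      rw [← shiftedFactorial_succ_right, ← shiftedFactorial_succ_left]
      ring
    rw [h, h, h, hs, choose_succ_two]
    simp only [selbergTerm, shiftedFactorial_succ_right]
    generalize N.choose 2 = c at *
    generalize shiftedFactorial N m = F at *
    interval_cases i <;> norm_num at ih ⊢ <;> linear_combination ih

lemma X_pow_dvd_selbergSum_sub {N m i : ℕ} (hi : i < 3) :
    (X : ℤ⟦X⟧) ^ N ∣ selbergSum N (i + 1) m -
      (selbergSum N i m + X ^ (i * (m + 1)) * selbergSum N (3 - i) (m + 1)) := by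
  have h := selbergSum_sub N m i hi
  have hN : N ≤ 3 * N * m + 7 * N.choose 2 + (6 - i) * N := by
    have : 1 * N ≤ (6 - i) * N := Nat.mul_le_mul_right N (by omega)
    omega
  obtain ⟨u, hu⟩ := pow_dvd_pow (X : ℤ⟦X⟧) hN
  refine ⟨-((-1) ^ N * (1 - X ^ N) * shiftedFactorial N m * u), ?_⟩
  rw [hu] at h
  linear_combination h

lemma X_pow_dvd_selbergSum_sub_shiftedFactorial {N m i : ℕ} (hN : 0 < N) (hi : 0 < i)
    (hi' : i ≤ 3) : (X : ℤ⟦X⟧) ^ (m + 1) ∣ selbergSum N i m - shiftedFactorial 0 m := by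
  obtain ⟨N, rfl⟩ : ∃ M, N = M + 1 := ⟨N - 1, by omega⟩
  have h0 : selbergTerm i m 0 = (1 - X ^ (i * (m + 1))) * shiftedFactorial 0 m := by
    simp [selbergTerm]
  have h1 : (X : ℤ⟦X⟧) ^ (m + 1) ∣ X ^ (i * (m + 1)) := pow_dvd_pow X (Nat.le_mul_of_pos_left _ hi)
  have h2 : ∀ n, (X : ℤ⟦X⟧) ^ (m + 1) ∣ selbergTerm i m (n + 1) := by
    intro n
    have : 1 * (n + 1) ≤ (7 - i) * (n + 1) := Nat.mul_le_mul_right _ (by omega)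
    have hle : m + 1 ≤ 3 * (n + 1) * m + 7 * (n + 1).choose 2 + (7 - i) * (n + 1) := by
      nlinarith
    exact (((pow_dvd_pow X hle).mul_left _).mul_right _).mul_right _
  rw [selbergSum, Finset.sum_range_succ', h0, add_sub_assoc]
  refine (Finset.dvd_sum fun n _ => h2 n).add ?_
  rw [show (1 - X ^ (i * (m + 1))) * shiftedFactorial 0 m - shiftedFactorial 0 m =
    -(X ^ (i * (m + 1)) * shiftedFactorial 0 m) by ring]
  exact (h1.mul_right _).neg_right

/-- The `q`-factorial `(1 - q) (1 - q ^ 2) ⋯ (1 - q ^ n)`. -/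
def qFactorial {R : Type*} [CommRing R] (q : R) (n : ℕ) : R :=
  ∏ i ∈ Finset.range n, (1 - q ^ (i + 1))

/-- The Gaussian binomial coefficient. -/
def gaussBinom {R : Type*} [CommRing R] (q : R) : ℕ → ℕ → R
  | _, 0 => 1
  | 0, _ + 1 => 0
  | n + 1, k + 1 => q ^ (k + 1) * gaussBinom q n (k + 1) + gaussBinom q n k

section Gauss

variable {R : Type*} [CommRing R]

lemma qFactorial_succ (q : R) (n : ℕ) :
    qFactorial q (n + 1) = qFactorial q n * (1 - q ^ (n + 1)) :=
  Finset.prod_range_succ _ _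

lemma gaussBinom_zero_right (q : R) (n : ℕ) : gaussBinom q n 0 = 1 := by
  cases n <;> rfl

lemma gaussBinom_succ_succ (q : R) (n k : ℕ) :
    gaussBinom q (n + 1) (k + 1) = q ^ (k + 1) * gaussBinom q n (k + 1) + gaussBinom q n k := rfl

lemma gaussBinom_eq_zero (q : R) {n k : ℕ} (h : n < k) : gaussBinom q n k = 0 := by
  induction n generalizing k with
  | zero => obtain ⟨k, rfl⟩ : ∃ j, k = j + 1 := ⟨k - 1, by omega⟩; rfl
  | succ n ih =>
    obtain ⟨k, rfl⟩ : ∃ j, k = j + 1 := ⟨k - 1, by omega⟩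
    rw [gaussBinom_succ_succ, ih (by omega), ih (by omega)]
    ring

lemma gaussBinom_self (q : R) (n : ℕ) : gaussBinom q n n = 1 := by
  induction n with
  | zero => rfl
  | succ n ih => rw [gaussBinom_succ_succ, ih, gaussBinom_eq_zero q (by omega)]; ring

lemma gaussBinom_mul_qFactorial (q : R) (k l : ℕ) :
    gaussBinom q (k + l) k * (qFactorial q k * qFactorial q l) = qFactorial q (k + l) := by
  induction k generalizing l with
  | zero => simp [gaussBinom_zero_right, qFactorial]
  | succ k ihk =>
    induction l with
    | zero => simp [gaussBinom_self, qFactorial]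
    | succ l ihl =>
      have h1 := ihk (l + 1)
      rw [show k + 1 + (l + 1) = (k + 1 + l) + 1 by ring, gaussBinom_succ_succ]
      rw [show k + (l + 1) = k + 1 + l by ring] at h1
      have h2 := qFactorial_succ q k
      have h3 := qFactorial_succ q l
      have h4 := qFactorial_succ q (k + 1 + l)
      linear_combination q ^ (k + 1) * (1 - q ^ (l + 1)) * ihl + (1 - q ^ (k + 1)) * h1 +
        gaussBinom q (k + 1 + l) k * qFactorial q (l + 1) * h2 +
        q ^ (k + 1) * gaussBinom q (k + 1 + l) (k + 1) * qFactorial q (k + 1) * h3 - h4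

/-- The homogeneous `q`-binomial theorem. -/
lemma prod_add_mul_pow (q x y : R) (M : ℕ) :
    ∏ i ∈ Finset.range M, (x + y * q ^ i) =
      ∑ k ∈ Finset.range (M + 1), q ^ k.choose 2 * gaussBinom q M k * x ^ (M - k) * y ^ k := by
  induction M generalizing y with
  | zero => simp [gaussBinom]
  | succ M ih =>
    have h : ∏ i ∈ Finset.range M, (x + y * q ^ (i + 1)) =
        ∏ i ∈ Finset.range M, (x + (y * q) * q ^ i) :=
      Finset.prod_congr rfl fun i _ => by ring
    rw [Finset.prod_range_succ', h, ih, mul_add]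
    have h1 : (∑ k ∈ Finset.range (M + 1), q ^ k.choose 2 * gaussBinom q M k * x ^ (M - k) *
        (y * q) ^ k) * x = (∑ k ∈ Finset.range (M + 1), q ^ (k + 1).choose 2 *
        (q ^ (k + 1) * gaussBinom q M (k + 1)) * x ^ (M + 1 - (k + 1)) * y ^ (k + 1)) +
        x ^ (M + 1) := by
      rw [Finset.sum_range_succ', Finset.sum_range_succ, gaussBinom_eq_zero q (Nat.lt_succ_self M)]
      simp only [gaussBinom_zero_right]
      rw [add_mul, Finset.sum_mul]
      congr 1
      · simp only [mul_zero, zero_mul, add_zero]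
        refine Finset.sum_congr rfl fun k hk => ?_
        have hk := Finset.mem_range.1 hk
        rw [show M + 1 - (k + 1) = (M - (k + 1)) + 1 by omega]
        ring
      · simp only [Nat.choose_zero_succ, tsub_zero]; ring
    have h2 : (∑ k ∈ Finset.range (M + 1), q ^ k.choose 2 * gaussBinom q M k * x ^ (M - k) *
        (y * q) ^ k) * y = ∑ k ∈ Finset.range (M + 1), q ^ (k + 1).choose 2 *
        gaussBinom q M k * x ^ (M + 1 - (k + 1)) * y ^ (k + 1) := by
      rw [Finset.sum_mul]
      refine Finset.sum_congr rfl fun k hk => ?_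
      rw [choose_succ_two, show M + 1 - (k + 1) = M - k by omega]
      ring
    rw [pow_zero, mul_one, h1, h2, Finset.sum_range_succ' _ (M + 1)]
    simp only [gaussBinom_succ_succ, gaussBinom_zero_right]
    rw [add_right_comm, ← Finset.sum_add_distrib]
    congr 1
    · exact Finset.sum_congr rfl fun k _ => by ring
    · simp

end Gauss

lemma choose_add_two (a b : ℕ) : (a + b).choose 2 = a.choose 2 + b.choose 2 + a * b := by
  induction b with
  | zero => simp
  | succ b ih => rw [← add_assoc, choose_succ_two, choose_succ_two, ih]; ring

/-- A finite form of the Jacobi triple product. -/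
lemma prod_one_sub_mul_one_sub (N : ℕ) :
    ∏ j ∈ Finset.range N, ((1 - (X : ℤ⟦X⟧) ^ (7 * j + 5)) * (1 - X ^ (7 * j + 2))) =
      ∑ n ∈ Finset.range N, ((-1) ^ n * X ^ (7 * n.choose 2 + 5 * n) *
          gaussBinom (X ^ 7) (2 * N) (N + n) +
        (-1) ^ (n + 1) * X ^ (7 * (n + 1).choose 2 + 2 * (n + 1)) *
          gaussBinom (X ^ 7) (2 * N) (N - 1 - n)) +
      (-1) ^ N * X ^ (7 * N.choose 2 + 5 * N) := by
  have h := prod_add_mul_pow ((X : ℤ⟦X⟧) ^ 7) (X ^ (7 * N)) (-X ^ 5) (2 * N)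
  set E := 7 * N * N + 7 * N.choose 2 + 5 * N with hE
  have hl : ∏ i ∈ Finset.range (2 * N), ((X : ℤ⟦X⟧) ^ (7 * N) + -X ^ 5 * (X ^ 7) ^ i) =
      (-1) ^ N * X ^ E *
        ∏ j ∈ Finset.range N, ((1 - (X : ℤ⟦X⟧) ^ (7 * j + 5)) * (1 - X ^ (7 * j + 2))) := by
    have h1 : ∏ i ∈ Finset.range N, ((X : ℤ⟦X⟧) ^ (7 * N) + -X ^ 5 * (X ^ 7) ^ i) =
        (∏ i ∈ Finset.range N, -X ^ (7 * i + 5)) *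
          ∏ i ∈ Finset.range N, (1 - X ^ (7 * i + 2)) := by
      rw [← Finset.prod_range_reflect (fun i => 1 - (X : ℤ⟦X⟧) ^ (7 * i + 2)),
        ← Finset.prod_mul_distrib]
      refine Finset.prod_congr rfl fun i hi => ?_
      have hi := Finset.mem_range.1 hi
      rw [show 7 * N = (7 * i + 5) + (7 * (N - 1 - i) + 2) by omega]
      ring
    have h2 : ∏ i ∈ Finset.range N, ((X : ℤ⟦X⟧) ^ (7 * N) + -X ^ 5 * (X ^ 7) ^ (N + i)) =
        X ^ (7 * N * N) * ∏ i ∈ Finset.range N, (1 - X ^ (7 * i + 5)) := by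
      rw [pow_mul X (7 * N) N, ← Finset.card_range N, ← Finset.prod_const, Finset.card_range,
        ← Finset.prod_mul_distrib]
      refine Finset.prod_congr rfl fun i hi => ?_
      ring
    have h3 : ∀ N : ℕ, ∏ i ∈ Finset.range N, -(X : ℤ⟦X⟧) ^ (7 * i + 5) =
        (-1) ^ N * X ^ (7 * N.choose 2 + 5 * N) := by
      intro N
      induction N with
      | zero => simp
      | succ N ih => rw [Finset.prod_range_succ, ih, choose_succ_two]; ring
    rw [two_mul, Finset.prod_range_add, h1, h2, h3, Finset.prod_mul_distrib, hE]
    ring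
  have hr : ∑ k ∈ Finset.range (2 * N + 1), ((X : ℤ⟦X⟧) ^ 7) ^ k.choose 2 *
      gaussBinom (X ^ 7) (2 * N) k * (X ^ (7 * N)) ^ (2 * N - k) * (-X ^ 5) ^ k =
      (-1) ^ N * X ^ E * (∑ n ∈ Finset.range N, ((-1) ^ n * X ^ (7 * n.choose 2 + 5 * n) *
          gaussBinom (X ^ 7) (2 * N) (N + n) +
        (-1) ^ (n + 1) * X ^ (7 * (n + 1).choose 2 + 2 * (n + 1)) *
          gaussBinom (X ^ 7) (2 * N) (N - 1 - n)) +
      (-1) ^ N * X ^ (7 * N.choose 2 + 5 * N)) := by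
    have h1 : ∀ n ≤ N, ((X : ℤ⟦X⟧) ^ 7) ^ (N + n).choose 2 *
        gaussBinom (X ^ 7) (2 * N) (N + n) * (X ^ (7 * N)) ^ (2 * N - (N + n)) *
          (-X ^ 5) ^ (N + n) = (-1) ^ N * X ^ E * ((-1) ^ n * X ^ (7 * n.choose 2 + 5 * n) *
          gaussBinom (X ^ 7) (2 * N) (N + n)) := by
      intro n hn
      have hexp : 7 * (N + n).choose 2 + 7 * N * (2 * N - (N + n)) + 5 * (N + n) =
          E + (7 * n.choose 2 + 5 * n) := by
        obtain ⟨r, rfl⟩ := Nat.exists_eq_add_of_le hn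
        rw [hE, choose_add_two (n + r) n, show 2 * (n + r) - (n + r + n) = r by omega]
        ring
      have hx := congrArg (fun e => (X : ℤ⟦X⟧) ^ e) hexp
      simp only [pow_add] at hx
      simp only [← pow_mul, neg_pow (X ^ 5 : ℤ⟦X⟧)]
      simp only [pow_add] at hx ⊢
      linear_combination (-1) ^ N * (-1) ^ n * gaussBinom (X ^ 7 : ℤ⟦X⟧) (2 * N) (N + n) * hx
    have h2 : ∀ n < N, ((X : ℤ⟦X⟧) ^ 7) ^ (N - 1 - n).choose 2 *
        gaussBinom (X ^ 7) (2 * N) (N - 1 - n) * (X ^ (7 * N)) ^ (2 * N - (N - 1 - n)) *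
          (-X ^ 5) ^ (N - 1 - n) = (-1) ^ N * X ^ E * ((-1) ^ (n + 1) *
          X ^ (7 * (n + 1).choose 2 + 2 * (n + 1)) *
          gaussBinom (X ^ 7) (2 * N) (N - 1 - n)) := by
      intro n hn
      have hexp : 7 * (N - 1 - n).choose 2 + 7 * N * (2 * N - (N - 1 - n)) + 5 * (N - 1 - n) =
          E + (7 * (n + 1).choose 2 + 2 * (n + 1)) := by
        obtain ⟨r, rfl⟩ := Nat.exists_eq_add_of_le hn
        have h3 := choose_add_two (n + 1) r
        have h4 := choose_add_two (n + 1) (n + 1)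
        have h5 := choose_succ_two (n + 1)
        have h7 : 2 * (n + 1).choose 2 = (n + 1) * n := by
          rw [Nat.choose_two_right, Nat.mul_div_cancel']
          · simp
          · exact (Nat.even_mul_pred_self (n + 1)).two_dvd
        rw [hE, Nat.succ_eq_add_one, show n + 1 + r - 1 - n = r by omega,
          show 2 * (n + 1 + r) - r = 2 * (n + 1) + r by omega, h3]
        nlinarith
      have hsgn : (-1 : ℤ⟦X⟧) ^ (N - 1 - n) = (-1) ^ N * (-1) ^ (n + 1) := by
        conv_rhs => rw [show N = (N - 1 - n) + (n + 1) by omega]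
        rw [pow_add, mul_assoc, ← mul_pow]
        simp
      have hx := congrArg (fun e => (X : ℤ⟦X⟧) ^ e) hexp
      simp only [← pow_mul, neg_pow (X ^ 5 : ℤ⟦X⟧), hsgn]
      generalize gaussBinom (X ^ 7 : ℤ⟦X⟧) (2 * N) (N - 1 - n) = g
      generalize (N - 1 - n) = r at *
      simp only [pow_add] at hx ⊢
      linear_combination (-1) ^ N * ((-1) ^ n * (-1) ^ 1) * g * hx
    have hlast := h1 N le_rfl
    rw [← two_mul] at hlast
    rw [Finset.sum_range_succ, hlast, gaussBinom_self, mul_one, mul_add, Finset.sum_add_distrib, mul_add]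
    congr 1
    rw [Finset.mul_sum, Finset.mul_sum]
    conv_lhs => rw [two_mul, Finset.sum_range_add, ← Finset.sum_range_reflect, ← two_mul, add_comm]
    congr 1
    · exact Finset.sum_congr rfl fun n hn => h1 n (Finset.mem_range.1 hn).le
    · exact Finset.sum_congr rfl fun n hn => h2 n (Finset.mem_range.1 hn)
  rw [hl, hr] at h
  exact mul_left_cancel₀ (mul_ne_zero (pow_ne_zero _ (neg_ne_zero.2 one_ne_zero))
    (pow_ne_zero _ X_ne_zero)) h

lemma pow_dvd_qFactorial_sub {R : Type*} [CommRing R] (q : R) {r n : ℕ} (h : r ≤ n) :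
    q ^ (r + 1) ∣ qFactorial q n - qFactorial q r := by
  induction n, h using Nat.le_induction with
  | base => simp
  | succ n hn ih =>
    rw [qFactorial_succ, show qFactorial q n * (1 - q ^ (n + 1)) - qFactorial q r =
      (qFactorial q n - qFactorial q r) - qFactorial q n * q ^ (n + 1) by ring]
    exact dvd_sub ih ((pow_dvd_pow q (by omega)).mul_left _)

lemma isUnit_qFactorial_X_pow {s : ℕ} (hs : 0 < s) (n : ℕ) :
    IsUnit (qFactorial ((X : ℤ⟦X⟧) ^ s) n) := by
  rw [isUnit_iff_constantCoeff, qFactorial, map_prod]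
  simp [hs.ne']

lemma pow_dvd_gaussBinom_mul_qFactorial_sub_one {R : Type*} [CommRing R] {q : R} {r k l L : ℕ}
    (hq : ∀ n, IsUnit (qFactorial q n)) (hk : r ≤ k) (hl : r ≤ l) (hL : r ≤ L) :
    q ^ (r + 1) ∣ gaussBinom q (k + l) k * qFactorial q L - 1 := by
  rw [← ((hq k).mul (hq l)).dvd_mul_left]
  obtain ⟨a, ha⟩ := pow_dvd_qFactorial_sub q hk
  obtain ⟨b, hb⟩ := pow_dvd_qFactorial_sub q hl
  obtain ⟨c, hc⟩ := pow_dvd_qFactorial_sub q hL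
  obtain ⟨d, hd⟩ := pow_dvd_qFactorial_sub q (hk.trans (Nat.le_add_right k l))
  refine ⟨qFactorial q L * d + qFactorial q r * c - qFactorial q l * a - qFactorial q r * b, ?_⟩
  linear_combination qFactorial q L * gaussBinom_mul_qFactorial q k l + qFactorial q L * hd +
    qFactorial q r * hc - qFactorial q l * ha - qFactorial q r * hb

lemma selbergTerm_two_zero (n : ℕ) : selbergTerm 2 0 n =
    (-1) ^ n * X ^ (7 * n.choose 2 + 5 * n) +
      (-1) ^ (n + 1) * X ^ (7 * (n + 1).choose 2 + 2 * (n + 1)) := by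
  rw [selbergTerm, choose_succ_two, shiftedFactorial, Finset.prod_range_zero]
  norm_num
  ring

lemma X_pow_dvd_qFactorial_mul_prod_sub_selbergSum (N : ℕ) : (X : ℤ⟦X⟧) ^ N ∣
    qFactorial (X ^ 7) N *
      ∏ j ∈ Finset.range N, ((1 - X ^ (7 * j + 5)) * (1 - X ^ (7 * j + 2))) -
    selbergSum N 2 0 := by
  have hq := isUnit_qFactorial_X_pow (s := 7) (by norm_num)
  have aux : ∀ {r k l e : ℕ} (s : ℤ⟦X⟧), r ≤ k → r ≤ l → r ≤ N → k + l = 2 * N →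
      N ≤ e + 7 * (r + 1) → (X : ℤ⟦X⟧) ^ N ∣
        s * X ^ e * (gaussBinom (X ^ 7) (2 * N) k * qFactorial (X ^ 7) N - 1) := by
    intro r k l e s hk hl hN hkl he
    refine (pow_dvd_pow X he).trans ?_
    rw [pow_add, pow_mul, ← hkl]
    exact mul_dvd_mul (dvd_mul_left _ _) (pow_dvd_gaussBinom_mul_qFactorial_sub_one hq hk hl hN)
  have hlast : (X : ℤ⟦X⟧) ^ N ∣
      qFactorial (X ^ 7) N * ((-1) ^ N * X ^ (7 * N.choose 2 + 5 * N)) :=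
    ((pow_dvd_pow X (by omega)).mul_left _).mul_left _
  rw [prod_one_sub_mul_one_sub, selbergSum, mul_add, add_sub_right_comm, Finset.mul_sum,
    ← Finset.sum_sub_distrib]
  refine (Finset.dvd_sum fun n hn => ?_).add hlast
  have hn := Finset.mem_range.1 hn
  have h1 := aux (r := N - n) (k := N + n) (l := N - n) (e := 7 * n.choose 2 + 5 * n) ((-1) ^ n)
    (by omega) (by omega) (by omega) (by omega) (by omega)
  have h2 := aux (r := N - 1 - n) (k := N - 1 - n) (l := N + 1 + n)
    (e := 7 * (n + 1).choose 2 + 2 * (n + 1)) ((-1) ^ (n + 1))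
    (by omega) (by omega) (by omega) (by omega) (by omega)
  convert h1.add h2 using 1
  rw [selbergTerm_two_zero]
  ring

/-- The residue classes `±1` and `±3` modulo `7`. -/
def IsAdmissible (x : ℕ) : Prop := x % 7 = 1 ∨ x % 7 = 3 ∨ x % 7 = 4 ∨ x % 7 = 6

instance : DecidablePred IsAdmissible := fun x => by unfold IsAdmissible; infer_instance

/-- The generating function of partitions into parts `≡ ±1, ±3 (mod 7)` that are at most `M`. -/
noncomputable def admissibleGenFun (M : ℕ) : ℤ⟦X⟧ :=
  mk fun n => ((Nat.Partition.restricted n fun x => IsAdmissible x ∧ x ≤ M).card : ℤ)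

open PowerSeries.WithPiTopology in
lemma admissibleGenFun_mul_prod (M : ℕ) : admissibleGenFun M *
    ∏ i ∈ Finset.range M, (if IsAdmissible (i + 1) then 1 - X ^ (i + 1) else 1) = 1 := by
  have h := Nat.Partition.hasProd_powerSeriesMk_card_restricted ℤ
    fun x => IsAdmissible x ∧ x ≤ M
  have h' : admissibleGenFun M = _ := h.unique (hasProd_prod_of_ne_finset_one
    (s := Finset.range M) fun i hi => if_neg fun hc => hi (Finset.mem_range.2 hc.2))
  rw [h', ← Finset.prod_mul_distrib]
  refine Finset.prod_eq_one fun i hi => ?_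
  have hi : i + 1 ≤ M := Finset.mem_range.1 hi
  by_cases hc : IsAdmissible (i + 1)
  · simp only [hc, hi, and_self, if_true, pow_mul]
    exact tsum_pow_mul_one_sub_of_constantCoeff_eq_zero (by simp)
  · simp [hc]

lemma qFactorial_X_eq (N : ℕ) : qFactorial (X : ℤ⟦X⟧) (7 * N) =
    (∏ i ∈ Finset.range (7 * N), (if IsAdmissible (i + 1) then 1 - X ^ (i + 1) else 1)) *
      (qFactorial (X ^ 7) N *
        ∏ j ∈ Finset.range N, ((1 - X ^ (7 * j + 5)) * (1 - X ^ (7 * j + 2)))) := by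
  induction N with
  | zero => simp [qFactorial]
  | succ N ih =>
    have h (r : ℕ) : IsAdmissible (7 * N + r) ↔ IsAdmissible r := by
      simp only [IsAdmissible, Nat.mul_add_mod]
    have h1 : IsAdmissible 1 := by decide
    have h2 : ¬ IsAdmissible 2 := by decide
    have h3 : IsAdmissible 3 := by decide
    have h4 : IsAdmissible 4 := by decide
    have h5 : ¬ IsAdmissible 5 := by decide
    have h6 : IsAdmissible 6 := by decide
    have h7 : ¬ IsAdmissible 7 := by decide
    rw [show 7 * (N + 1) = 7 * N + 1 + 1 + 1 + 1 + 1 + 1 + 1 by ring]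
    simp only [qFactorial_succ, Finset.prod_range_succ, ih, add_assoc, Nat.reduceAdd]
    simp only [h, h1, h2, h3, h4, h5, h6, h7, if_true, if_false]
    ring

lemma admissibleGenFun_mul_qFactorial (N : ℕ) :
    admissibleGenFun (7 * N) * qFactorial X (7 * N) = qFactorial (X ^ 7) N *
      ∏ j ∈ Finset.range N, ((1 - X ^ (7 * j + 5)) * (1 - X ^ (7 * j + 2))) := by
  rw [qFactorial_X_eq, ← mul_assoc, admissibleGenFun_mul_prod, one_mul]

lemma shiftedFactorial_zero (m : ℕ) : shiftedFactorial 0 m = qFactorial X m := by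
  simp [shiftedFactorial, qFactorial]

lemma X_pow_dvd_qFactorial_mul_genFun_sub_selbergSum (K : ℕ) (hK : 0 < K) : (X : ℤ⟦X⟧) ^ K ∣
    qFactorial X (7 * K) * genFun (rankAvoiding 1 0) - selbergSum K 2 0 := by
  have hlarge : ∀ i m s, 0 < i → i ≤ 3 → K ≤ m → (X : ℤ⟦X⟧) ^ K ∣
      qFactorial X (7 * K) * genFun (rankAvoiding (m + 1) s) - selbergSum K i m := by
    intro i m s hi hi' hm
    have h1 := (pow_dvd_pow X (show K ≤ m + 1 by omega)).trans
      (X_pow_dvd_genFun_rankAvoiding_sub_one (m + 1) s)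
    have h2 := (pow_dvd_pow X (show K ≤ m + 1 by omega)).trans
      (X_pow_dvd_selbergSum_sub_shiftedFactorial hK hi hi' (m := m))
    have h3 := (pow_dvd_pow X (Nat.le_succ K)).trans (pow_dvd_qFactorial_sub (X : ℤ⟦X⟧) hm)
    have h4 := (pow_dvd_pow X (Nat.le_succ K)).trans
      (pow_dvd_qFactorial_sub (X : ℤ⟦X⟧) (show K ≤ 7 * K by omega))
    rw [shiftedFactorial_zero] at h2
    convert (((h1.mul_left (qFactorial X (7 * K))).sub h2).sub h3).add h4 using 1
    ring
  refine X_pow_dvd_of_recurrence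
    (f := fun m => qFactorial X (7 * K) * genFun (rankAvoiding (m + 1) 0) - selbergSum K 2 m)
    (g := fun m => qFactorial X (7 * K) * genFun (rankAvoiding (m + 1) 1) - selbergSum K 1 m)
    (fun m => ?_) (fun m => ?_) (fun m => hlarge 2 m 0 (by norm_num) (by norm_num))
    (fun m => hlarge 1 m 1 (by norm_num) (by norm_num))
  · have h1 := X_pow_dvd_selbergSum_sub (N := K) (m := m) (i := 1) (by norm_num)
    have h2 := genFun_rankAvoiding_zero (m + 1)
    norm_num at h1
    convert h1.neg_right using 1
    linear_combination qFactorial X (7 * K) * h2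
  · have h1 := X_pow_dvd_selbergSum_sub (N := K) (m := m) (i := 0) (by norm_num)
    have h2 := X_pow_dvd_selbergSum_sub (N := K) (m := m + 1) (i := 2) (by norm_num)
    have h3 := genFun_rankAvoiding_one (m + 1)
    norm_num [selbergSum_zero] at h1 h2
    convert (h1.add h2).neg_right using 1
    linear_combination qFactorial X (7 * K) * h3

lemma card_admissible_partitions (n : ℕ) :
    (Nat.card {p : Nat.Partition n //
        ∀ x ∈ p.parts, x % 7 = 1 ∨ x % 7 = 3 ∨ x % 7 = 4 ∨ x % 7 = 6} : ℤ) =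
      coeff n (genFun (rankAvoiding 1 0)) := by
  set K := n + 1 with hK
  have h1 : (X : ℤ⟦X⟧) ^ K ∣ qFactorial (X ^ 1) (7 * K) *
      (genFun (rankAvoiding 1 0) - admissibleGenFun (7 * K)) := by
    convert (X_pow_dvd_qFactorial_mul_genFun_sub_selbergSum K (by omega)).sub
      (X_pow_dvd_qFactorial_mul_prod_sub_selbergSum K) using 1
    rw [← admissibleGenFun_mul_qFactorial, pow_one]
    ring
  rw [(isUnit_qFactorial_X_pow one_pos _).dvd_mul_left, X_pow_dvd_iff] at h1
  have h2 := h1 n (by omega)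
  rw [map_sub, sub_eq_zero] at h2
  rw [h2, admissibleGenFun, coeff_mk, Nat.card_eq_fintype_card, Fintype.card_subtype,
    Nat.Partition.restricted]
  congr 2
  ext p
  simp only [Finset.mem_filter, Finset.mem_univ, true_and]
  refine forall₂_congr fun x hx => ?_
  have := p.le_of_mem_parts hx
  exact (and_iff_left (by omega)).symm

end RogersSelberg

/-- interpretation of Rogers–Selberg S32: `A(n) = B(n) = C(n)`.
Bipartitions are modelled as pairs of multisets of positive integers whose
total sum is `n`.  For `x` the `j`-th part of the distinct-part partition `π`
listed in ascending order, `j` is realized as the number of parts of `π`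
that are `≤ x`. -/
theorem rogers_selberg_S32_interpretation (n : ℕ) (hn : 0 < n) :
    -- A(n): partitions of n into parts ≡ ±1, ±3 (mod 7)
    (Nat.card {p : Nat.Partition n //
        ∀ x ∈ p.parts, x % 7 = 1 ∨ x % 7 = 3 ∨ x % 7 = 4 ∨ x % 7 = 6} =
      -- B(n)
      Nat.card {pl : Multiset ℕ × Multiset ℕ //
        (∀ x ∈ pl.1, 0 < x) ∧ (∀ x ∈ pl.2, 0 < x) ∧ pl.1.sum + pl.2.sum = n ∧
        pl.1.Nodup ∧ (∀ x ∈ pl.1, Even x ∧ 2 < x) ∧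
        (∀ x ∈ pl.1, ∀ y ∈ pl.1, x < y → x + 4 ≤ y) ∧
        pl.2.Nodup ∧
        ∀ x ∈ pl.1,
          x / 2 - 1 ∉ pl.2 ∧ x / 2 ∉ pl.2 ∧ x / 2 + 1 ∉ pl.2}) ∧
    -- B(n) = C(n)
    (Nat.card {pl : Multiset ℕ × Multiset ℕ //
        (∀ x ∈ pl.1, 0 < x) ∧ (∀ x ∈ pl.2, 0 < x) ∧ pl.1.sum + pl.2.sum = n ∧
        pl.1.Nodup ∧ (∀ x ∈ pl.1, Even x ∧ 2 < x) ∧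
        (∀ x ∈ pl.1, ∀ y ∈ pl.1, x < y → x + 4 ≤ y) ∧
        pl.2.Nodup ∧
        ∀ x ∈ pl.1,
          x / 2 - 1 ∉ pl.2 ∧ x / 2 ∉ pl.2 ∧ x / 2 + 1 ∉ pl.2} =
      Nat.card {pl : Multiset ℕ × Multiset ℕ //
        (∀ x ∈ pl.1, 0 < x) ∧ (∀ x ∈ pl.2, 0 < x) ∧ pl.1.sum + pl.2.sum = n ∧
        pl.1.Nodup ∧ (∀ x ∈ pl.1, Even x ∧ 2 < x) ∧
        (∀ x ∈ pl.1, ∀ y ∈ pl.1, x < y → x + 4 ≤ y) ∧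
        pl.2.Nodup ∧
        ∀ x ∈ pl.1,
          x / 2 + (pl.1.filter (fun y => y ≤ x)).card - 2 ∉ pl.2 ∧
          x / 2 + (pl.1.filter (fun y => y ≤ x)).card - 1 ∉ pl.2 ∧
          x / 2 + (pl.1.filter (fun y => y ≤ x)).card ∉ pl.2}) := by
  have hA := RogersSelberg.card_admissible_partitions n
  have hB := RogersSelberg.card_near_bipartitions n
  have hC := RogersSelberg.card_rank_bipartitions n
  rw [RogersSelberg.genFun_nearAvoiding_eq_genFun_rankAvoiding] at hB
  exact ⟨Nat.cast_injective (hA.trans hB.symm), Nat.cast_injective (hB.trans hC.symm)⟩
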